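/- Assume π has nilpotency 4 (π^4 = 0, π^3 ≠ 0). Let r, b_{21}, b_{11}, b_{12}, b_{01}, b_{02}, b_{03} ∈ R[x] with r̄ irreducible in F[x], let e_0 ≥ e_1 ≥ e_2 ≥ e_3 ≥ 0 be integers with e_0 > 0, and let I be an ideal of R[x] with canonical sequence (f_0, f_1, f_2, f_3) where f_3 = r^{e_3}, f_2 = r^{e_2} + π b_{21}, f_1 = r^{e_1} + π(b_{21} r^{e_1−e_2} + b_{11} r^{e_3}) + π^2 b_{12}, and f_0 = r^{e_0} + π(b_{21} r^{e_0−e_2} + b_{11} r^{e_0−e_1+e_3} + b_{01} r^{e_2}) + π^2(b_{12} r^{e_0−e_1} + b_{01} b_{21} + b_{02} r^{e_3}) + π^3 b_{03}. Then: (i) if the set {e_0, e_1, e_2, e_3, 0} has exactly 2 elements, R[x]/I is Frobenius and local; (ii) if e_0 = e_1 = e_2 > e_3 > 0, it is Frobenius and local iff r̄ ∤ b̄_{21}; (iii) if e_0 = e_1 > e_2 = e_3 > 0, iff r̄ ∤ (b̄_{12} − b̄_{11} b̄_{21}); (iv) if e_0 = e_1 > e_2 > e_3 = 0, iff r̄ ∤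 b̄_{11}; (v) if e_0 = e_1 > e_2 > e_3 > 0, iff r̄ ∤ b̄_{21} and r̄ ∤ b̄_{11}; (vi) if e_0 > e_1 = e_2 = e_3 > 0, iff r̄ ∤ (b̄_{21}(b̄_{02} − b̄_{01} b̄_{11}) − (b̄_{03} − b̄_{01} b̄_{12})); (vii) if e_0 > e_1 = e_2 > e_3 = 0, iff r̄ ∤ (b̄_{02} − b̄_{01} b̄_{11}); (viii) if e_0 > e_1 > e_2 = e_3 = 0, iff r̄ ∤ b̄_{01}; (ix) if e_0 > e_1 = e_2 > e_3 > 0, iff r̄ ∤ b̄_{21} and r̄ ∤ (b̄_{02} − b̄_{01} b̄_{11}); (x) if e_0 > e_1 > e_2 = e_3 > 0, iff r̄ ∤ (b̄_{12} − b̄_{11} b̄_{21}) and r̄ ∤ b̄_{01}; (xi) if e_0 > e_1 > e_2 > e_3 = 0, iff r̄ ∤ b̄_{11} and r̄ ∤ b̄_{01}; (xii) if e_0 > e_1 > e_2 > e_3 > 0, iff r̄ ∤ b̄_{21}, r̄ ∤ b̄_{11}, and r̄ ∤ b̄_{01}. -/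

import Mathlib

open Polynomial

/-- A commutative ring `S` is *Frobenius* if it is artinian and `S/rad(S)` is isomorphic,
as an `S`-module, to the socle of `S` (the sum of all minimal ideals of `S`). -/
def IsFrobeniusRing (S : Type*) [CommRing S] : Prop :=
  IsArtinianRing S ∧
    Nonempty ((S ⧸ Ideal.jacobson (⊥ : Ideal S)) ≃ₗ[S]
      (sSup {J : Ideal S | IsAtom J} : Ideal S))

/-- The reduction map `R[x] → (R/πR)[x]`. -/
noncomputable def redMod {R : Type*} [CommRing R] (π : R) :
    R[X] →+* (R ⧸ Ideal.span {π})[X] :=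
  Polynomial.mapRingHom (Ideal.Quotient.mk (Ideal.span {π}))

/-- `(f 0, …, f (n-1))` is a canonical sequence of the ideal `I` of `R[x]`. -/
def IsCanonicalSequence {R : Type*} [CommRing R] (π : R) (n : ℕ)
    (I : Ideal R[X]) (f : ℕ → R[X]) : Prop :=
  ∀ i < n, (C π ^ i * f i ∈ I) ∧
    ∀ g : R[X], C π ^ i * g ∈ I →
      redMod π g = 0 ∨ (redMod π (f i) ≠ 0 ∧ (redMod π (f i)).degree ≤ (redMod π g).degree)

section Socle

variable {S : Type*} [CommRing S] [IsLocalRing S]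

theorem sSup_isAtom_eq_annihilator_maximalIdeal :
    sSup {J : Ideal S | IsAtom J} = (IsLocalRing.maximalIdeal S).annihilator := by
  apply le_antisymm
  · refine sSup_le fun J hJ x hx => Submodule.mem_annihilator.2 fun a ha => ?_
    have hle : Ideal.span {x * a} ≤ J :=
      (Ideal.span_singleton_le_iff_mem _).2 (J.mul_mem_right _ hx)
    rcases hJ.le_iff.1 hle with h | h
    · simpa using h
    · rw [← h] at hx
      obtain ⟨b, hb⟩ := Ideal.mem_span_singleton'.1 hx
      have hu : IsUnit (1 - b * a) := by
        by_contra hn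
        refine (IsLocalRing.maximalIdeal.isMaximal S).ne_top ((Ideal.eq_top_iff_one _).2 ?_)
        simpa using Ideal.add_mem _ ((IsLocalRing.mem_maximalIdeal _).2 hn)
          (Ideal.mul_mem_left _ b ha)
      have hx0 : (1 - b * a) * x = 0 := by linear_combination -hb
      rw [hu.mul_right_eq_zero] at hx0
      simp [hx0]
  · intro x hx
    by_cases hx0 : x = 0
    · simp [hx0]
    suffices h : IsAtom (Ideal.span {x}) from
      le_sSup (a := Ideal.span {x}) h (Ideal.mem_span_singleton_self x)
    refine ⟨by simpa using hx0, fun J hJ => ?_⟩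
    rw [eq_bot_iff]
    intro y hy
    obtain ⟨c, rfl⟩ := Ideal.mem_span_singleton'.1 (hJ.le hy)
    by_cases hc : c ∈ IsLocalRing.maximalIdeal S
    · simpa [mul_comm] using Submodule.mem_annihilator.1 hx c hc
    · refine absurd ((Ideal.span_singleton_le_iff_mem _).2 ?_) hJ.not_ge
      have hu : IsUnit c := by simpa using hc
      obtain ⟨d, hd⟩ := hu.exists_left_inv
      have := J.mul_mem_left d hy
      rwa [← mul_assoc, hd, one_mul] at this

/-- A local artinian ring is Frobenius iff any two elements of its socle are linearly
dependent over the residue field. -/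
theorem isFrobeniusRing_iff_socle_dependent [IsArtinianRing S] :
    IsFrobeniusRing S ↔ ∀ g ∈ (IsLocalRing.maximalIdeal S).annihilator,
      ∀ h ∈ (IsLocalRing.maximalIdeal S).annihilator, ∃ α β : S,
        (α ∉ IsLocalRing.maximalIdeal S ∨ β ∉ IsLocalRing.maximalIdeal S) ∧
          α * g + β * h = 0 := by
  rw [IsFrobeniusRing, and_iff_right (inferInstance : IsArtinianRing S),
    sSup_isAtom_eq_annihilator_maximalIdeal,
    IsLocalRing.jacobson_eq_maximalIdeal ⊥ bot_ne_top]
  constructor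
  · rintro ⟨e⟩ g hg h hh
    obtain ⟨a, ha⟩ := Ideal.Quotient.mk_surjective (e.symm ⟨g, hg⟩)
    obtain ⟨b, hb⟩ := Ideal.Quotient.mk_surjective (e.symm ⟨h, hh⟩)
    rw [LinearEquiv.eq_symm_apply] at ha hb
    have key (c d : S) : c * g + d * h =
        (e (Ideal.Quotient.mk (IsLocalRing.maximalIdeal S) (c * a + d * b)) : S) := by
      have : Ideal.Quotient.mk (IsLocalRing.maximalIdeal S) (c * a + d * b) =
        c • Ideal.Quotient.mk _ a + d • Ideal.Quotient.mk _ b := rfl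
      rw [this, map_add, map_smul, map_smul, ha, hb]
      rfl
    by_cases hab : a ∈ IsLocalRing.maximalIdeal S ∧ b ∈ IsLocalRing.maximalIdeal S
    · refine ⟨1, 0, Or.inl ?_, ?_⟩
      · simp
      · rw [key, one_mul, zero_mul, add_zero, Ideal.Quotient.eq_zero_iff_mem.2 hab.1]
        simp
    · refine ⟨b, -a, ?_, ?_⟩
      · rw [neg_mem_iff]
        tauto
      · rw [key, show b * a + -a * b = 0 by ring]
        simp
  · intro H
    obtain ⟨J, hJ⟩ := IsAtomic.exists_atom (Ideal S)
    obtain ⟨x, hxJ, hx0⟩ := Submodule.exists_mem_ne_zero_of_ne_bot hJ.1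
    have hx : x ∈ (IsLocalRing.maximalIdeal S).annihilator := by
      rw [← sSup_isAtom_eq_annihilator_maximalIdeal]
      exact le_sSup (a := J) hJ hxJ
    have hann := Submodule.mem_annihilator.1 hx
    let F : S →ₗ[S] (IsLocalRing.maximalIdeal S).annihilator :=
      LinearMap.toSpanSingleton S _ ⟨x, hx⟩
    have hF : Function.Surjective F := by
      rintro ⟨h, hh⟩
      obtain ⟨α, β, hαβ, h0⟩ := H x hx h hh
      by_cases hβ : β ∈ IsLocalRing.maximalIdeal S
      · exfalso
        have hα : IsUnit α := by
          have := hαβ.resolve_right (not_not.2 hβ)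
          simpa using this
        have := Submodule.mem_annihilator.1 hh β hβ
        rw [smul_eq_mul, mul_comm] at this
        rw [this, add_zero, hα.mul_right_eq_zero] at h0
        exact hx0 h0
      · have hu : IsUnit β := by simpa using hβ
        obtain ⟨d, hd⟩ := hu.exists_left_inv
        refine ⟨-(d * α), Subtype.ext ?_⟩
        change -(d * α) * x = h
        linear_combination h * hd - d * h0
    have hker : F.ker = IsLocalRing.maximalIdeal S := by
      ext a
      have : a ∈ F.ker ↔ a * x = 0 := by
        rw [LinearMap.mem_ker, ← Subtype.coe_inj]
        rfl
      rw [this]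
      constructor
      · intro h
        by_contra hn
        have hu : IsUnit a := by simpa using hn
        rw [hu.mul_right_eq_zero] at h
        exact hx0 h
      · intro h
        simpa [mul_comm] using hann a h
    exact ⟨(Submodule.quotEquivOfEq _ _ hker.symm).trans (F.quotKerEquivOfSurjective hF)⟩

end Socle

section Quotient

variable {P κ : Type*} [CommRing P] [Field κ] {φ : P →+* κ} {I : Ideal P}

theorem nilradical_quotient_eq_ker (hI : ∀ x ∈ I, φ x = 0)
    (hnil : ∀ x, φ x = 0 → ∃ k, x ^ k ∈ I) :
    nilradical (P ⧸ I) = RingHom.ker (Ideal.Quotient.lift I φ hI) := by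
  ext x
  obtain ⟨x, rfl⟩ := Ideal.Quotient.mk_surjective x
  rw [mem_nilradical, RingHom.mem_ker, Ideal.Quotient.lift_mk]
  constructor
  · rintro ⟨k, hk⟩
    rw [← map_pow, Ideal.Quotient.eq_zero_iff_mem] at hk
    exact eq_zero_of_pow_eq_zero (n := k) (by rw [← map_pow, hI _ hk])
  · intro h
    obtain ⟨k, hk⟩ := hnil x h
    exact ⟨k, by rwa [← map_pow, Ideal.Quotient.eq_zero_iff_mem]⟩

theorem frobenius_local_quotient_iff [IsNoetherianRing P] (hφ : Function.Surjective φ)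
    (hI : ∀ x ∈ I, φ x = 0) (hnil : ∀ x, φ x = 0 → ∃ k, x ^ k ∈ I) :
    IsFrobeniusRing (P ⧸ I) ∧ IsLocalRing (P ⧸ I) ↔
      ∀ g h : P, (∀ a, φ a = 0 → g * a ∈ I) → (∀ a, φ a = 0 → h * a ∈ I) →
        ∃ α β, (φ α ≠ 0 ∨ φ β ≠ 0) ∧ α * g + β * h ∈ I := by
  have hmax : (nilradical (P ⧸ I)).IsMaximal := by
    rw [nilradical_quotient_eq_ker hI hnil]
    exact RingHom.ker_isMaximal_of_surjective _
      (Ideal.Quotient.lift_surjective_of_surjective _ _ hφ)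
  have : IsLocalRing (P ⧸ I) := IsLocalRing.of_isMaximal_nilradical _
  have : Ring.KrullDimLE 0 (P ⧸ I) := Ring.KrullDimLE.of_isMaximal_nilradical _
  have : IsArtinianRing (P ⧸ I) := IsNoetherianRing.isArtinianRing_of_krullDimLE_zero
  have hmem (a : P) : Ideal.Quotient.mk I a ∈ IsLocalRing.maximalIdeal (P ⧸ I) ↔ φ a = 0 := by
    rw [← IsLocalRing.eq_maximalIdeal hmax, nilradical_quotient_eq_ker hI hnil, RingHom.mem_ker,
      Ideal.Quotient.lift_mk]
  have hann (g : P) : Ideal.Quotient.mk I g ∈ (IsLocalRing.maximalIdeal (P ⧸ I)).annihilator ↔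
      ∀ a, φ a = 0 → g * a ∈ I := by
    simp only [Submodule.mem_annihilator, Ideal.Quotient.mk_surjective.forall, hmem, smul_eq_mul,
      ← map_mul, Ideal.Quotient.eq_zero_iff_mem]
  rw [and_iff_left (inferInstance : IsLocalRing (P ⧸ I)), isFrobeniusRing_iff_socle_dependent]
  simp only [Ideal.Quotient.mk_surjective.forall, Ideal.Quotient.mk_surjective.exists, hmem, hann,
    ← map_mul, ← map_add, Ideal.Quotient.eq_zero_iff_mem]
  exact ⟨fun H g h hg hh => H g hg h hh, fun H g hg h hh => H g h hg hh⟩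

end Quotient

section KernelDependent

variable {n κ : Type*} [Fintype n] [Field κ]

/-- Any two elements of the kernel of `M` are linearly dependent, i.e. the kernel has
dimension at most one. -/
def KernelDependent (M : Matrix n n κ) : Prop :=
  ∀ w w' : n → κ, M.mulVec w = 0 → M.mulVec w' = 0 →
    ∃ α β : κ, (α ≠ 0 ∨ β ≠ 0) ∧ α • w + β • w' = 0

/-- If some kernel vector of `M` has nonzero `i`-th coordinate, the kernel is at most a line iff
the `i`-th coordinate is injective on it. -/
theorem kernelDependent_iff_of_apply_ne_zero {M : Matrix n n κ} {i : n} {u : n → κ}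
    (hu : M.mulVec u = 0) (hui : u i ≠ 0) :
    KernelDependent M ↔ ∀ w, M.mulVec w = 0 → w i = 0 → w = 0 := by
  constructor
  · intro H w hw hwi
    obtain ⟨α, β, hαβ, h⟩ := H u w hu hw
    have hα : α = 0 := by
      have := congrFun h i
      simpa [hwi, hui] using this
    have hβ : β ≠ 0 := by simpa [hα] using hαβ
    simpa [hα, hβ] using h
  · intro H w w' hw hw'
    by_cases h : w i = 0 ∧ w' i = 0
    · exact ⟨1, 0, by simp, by simp [H w hw h.1]⟩
    · refine ⟨w' i, -w i, by rw [neg_ne_zero]; tauto, H _ ?_ ?_⟩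
      · simp [Matrix.mulVec_add, Matrix.mulVec_smul, hw, hw', Matrix.mulVec_neg]
      · simp [mul_comm]

/-- If `I` is described, through a parametrisation `ψ` of `(I : p)`, by the column space of a
nonsingular matrix `M`, then the socle of `P ⧸ I` is the kernel of `M` modulo `r`. -/
theorem socle_dependent_iff_kernelDependent {P A : Type*} [CommRing P] [CommRing A] [IsDomain A]
    [DecidableEq n] {ρ : P →+* A} {σ : A →+* κ} (hρ : Function.Surjective ρ)
    (hσ : Function.Surjective σ) {r p : P} (hr : ρ r ≠ 0) (hp : ρ p = 0)
    (hker : ∀ a, σ a = 0 ↔ ρ r ∣ a) {M : Matrix n n A} (hM : M.det ≠ 0) {I : Ideal P}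
    (ψ : (n → P) →ₗ[P] P) (hψ : ∀ v, ψ v ∈ I ↔ ∃ w, ρ ∘ v = M.mulVec w)
    (hcolon : ∀ g, p * g ∈ I → ∃ v, ψ v = g) :
    (∀ g h : P, (∀ a, (σ.comp ρ) a = 0 → g * a ∈ I) → (∀ a, (σ.comp ρ) a = 0 → h * a ∈ I) →
        ∃ α β, ((σ.comp ρ) α ≠ 0 ∨ (σ.comp ρ) β ≠ 0) ∧ α * g + β * h ∈ I) ↔
      KernelDependent (M.map σ) := by
  have hcomp_smul (a : P) (v : n → P) : ρ ∘ (a • v) = ρ a • (ρ ∘ v) := by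
    ext; simp
  have hcomp_add (v w : n → P) : ρ ∘ (v + w) = ρ ∘ v + ρ ∘ w := by
    ext; simp
  have hMσ (w : n → A) : (M.map σ).mulVec (σ ∘ w) = σ ∘ M.mulVec w := by
    ext i; exact (RingHom.map_mulVec σ M w i).symm
  have hσ0 (w : n → A) : σ ∘ w = 0 ↔ ∃ v, w = ρ r • v := by
    constructor
    · intro h
      choose v hv using fun i => (hker (w i)).1 (congrFun h i)
      exact ⟨v, funext hv⟩
    · rintro ⟨v, rfl⟩
      ext i
      simp [(hker (ρ r)).2 dvd_rfl]
  have hinj := Matrix.mulVec_injective_of_det_ne_zero hM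
  have hsoc (v : n → P) : (∀ a, (σ.comp ρ) a = 0 → ψ v * a ∈ I) ↔
      ∃ w, ρ r • (ρ ∘ v) = M.mulVec w := by
    constructor
    · intro h
      have := h r ((hker _).2 dvd_rfl)
      rwa [mul_comm, ← smul_eq_mul, ← map_smul, hψ, hcomp_smul] at this
    · rintro ⟨w, hw⟩ a ha
      obtain ⟨c, hc⟩ := (hker _).1 ha
      rw [mul_comm, ← smul_eq_mul, ← map_smul, hψ, hcomp_smul]
      exact ⟨c • w, by rw [hc, mul_comm, mul_smul, hw, Matrix.mulVec_smul]⟩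
  have hmem_colon (g : P) (h : ∀ a, (σ.comp ρ) a = 0 → g * a ∈ I) : ∃ v, ψ v = g :=
    hcolon g (by rw [mul_comm]; exact h p (by simp [hp]))
  have hcomb (α β : P) {v v' : n → P} {w w' : n → A} (hw : ρ r • (ρ ∘ v) = M.mulVec w)
      (hw' : ρ r • (ρ ∘ v') = M.mulVec w') :
      α * ψ v + β * ψ v' ∈ I ↔ σ (ρ α) • (σ ∘ w) + σ (ρ β) • (σ ∘ w') = 0 := by
    have h1 : σ (ρ α) • (σ ∘ w) + σ (ρ β) • (σ ∘ w') = σ ∘ (ρ α • w + ρ β • w') := by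
      ext; simp
    rw [h1, hσ0, ← smul_eq_mul, ← smul_eq_mul, ← map_smul, ← map_smul, ← map_add, hψ, hcomp_add,
      hcomp_smul, hcomp_smul]
    have h2 : ρ r • (ρ α • (ρ ∘ v) + ρ β • (ρ ∘ v')) = M.mulVec (ρ α • w + ρ β • w') := by
      rw [Matrix.mulVec_add, Matrix.mulVec_smul, Matrix.mulVec_smul, ← hw, ← hw', smul_add,
        smul_comm (ρ r), smul_comm (ρ r)]
    refine exists_congr fun x => ⟨fun h => hinj ?_, fun h => ?_⟩
    · rw [← h2, h, Matrix.mulVec_smul]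
    · rw [h, Matrix.mulVec_smul] at h2
      exact smul_right_injective _ hr h2
  constructor
  · intro H w w' hw hw'
    obtain ⟨w, rfl⟩ := hσ.comp_left w
    obtain ⟨w', rfl⟩ := hσ.comp_left w'
    rw [hMσ, hσ0] at hw hw'
    obtain ⟨v, hv⟩ := hw
    obtain ⟨v', hv'⟩ := hw'
    obtain ⟨v, rfl⟩ := hρ.comp_left v
    obtain ⟨v', rfl⟩ := hρ.comp_left v'
    obtain ⟨α, β, hαβ, h⟩ := H (ψ v) (ψ v') ((hsoc v).2 ⟨w, hv.symm⟩) ((hsoc v').2 ⟨w', hv'.symm⟩)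
    exact ⟨_, _, hαβ, (hcomb α β hv.symm hv'.symm).1 h⟩
  · intro H g h hg hh
    obtain ⟨v, rfl⟩ := hmem_colon g hg
    obtain ⟨v', rfl⟩ := hmem_colon h hh
    obtain ⟨w, hw⟩ := (hsoc v).1 hg
    obtain ⟨w', hw'⟩ := (hsoc v').1 hh
    obtain ⟨α, β, hαβ, h0⟩ := H (σ ∘ w) (σ ∘ w')
      (by rw [hMσ, ← hw]; exact (hσ0 _).2 ⟨_, rfl⟩) (by rw [hMσ, ← hw']; exact (hσ0 _).2 ⟨_, rfl⟩)
    obtain ⟨α, rfl⟩ := (hσ.comp hρ) α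
    obtain ⟨β, rfl⟩ := (hσ.comp hρ) β
    exact ⟨α, β, hαβ, (hcomb α β hw hw').2 h0⟩

end KernelDependent

section Triangular

theorem Matrix.det_fin_four_lowerTriangular {A : Type*} [CommRing A]
    (d0 d1 d2 d3 a01 a02 a03 a11 a12 a21 : A) :
    !![d0, 0, 0, 0; a01, d1, 0, 0; a02, a11, d2, 0; a03, a12, a21, d3].det =
      d0 * d1 * d2 * d3 := by
  simp [Matrix.det_succ_row_zero, Fin.sum_univ_succ]
  ring

theorem Matrix.mulVec_fin_four_lowerTriangular {A : Type*} [CommRing A]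
    (d0 d1 d2 d3 a01 a02 a03 a11 a12 a21 : A) (w : Fin 4 → A) :
    !![d0, 0, 0, 0; a01, d1, 0, 0; a02, a11, d2, 0; a03, a12, a21, d3].mulVec w =
      ![d0 * w 0, a01 * w 0 + d1 * w 1, a02 * w 0 + a11 * w 1 + d2 * w 2,
        a03 * w 0 + a12 * w 1 + a21 * w 2 + d3 * w 3] := by
  ext i
  fin_cases i <;> simp [Matrix.mulVec, dotProduct, Fin.sum_univ_four]

variable {P A : Type*} [CommRing P] [CommRing A] {ρ : P →+* A} {r p : P}

theorem exists_eq_mul_add_of_map_mul_dvd [IsDomain A] (hρ : Function.Surjective ρ)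
    (hker : ∀ x, ρ x = 0 → p ∣ x) {s f f' y : P} (hf' : ρ f' ≠ 0) (hf : ρ f = ρ s * ρ f')
    (h : ρ f ∣ ρ (y * f')) : ∃ w u, y = s * w + p * u := by
  rw [hf, map_mul, mul_dvd_mul_iff_right hf'] at h
  obtain ⟨w, hw⟩ := h
  obtain ⟨w, rfl⟩ := hρ w
  obtain ⟨u, hu⟩ := hker (y - s * w) (by simp [hw])
  exact ⟨w, u, by linear_combination hu⟩

theorem exists_eq_mul_add_of_map_dvd (hρ : Function.Surjective ρ)
    (hker : ∀ x, ρ x = 0 → p ∣ x) {f y : P} (h : ρ f ∣ ρ y) : ∃ w u, y = f * w + p * u := by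
  obtain ⟨w, hw⟩ := h
  obtain ⟨w, rfl⟩ := hρ w
  obtain ⟨u, hu⟩ := hker (y - f * w) (by simp [hw])
  exact ⟨w, u, by linear_combination hu⟩

variable {f0 f1 f2 f3 b01 b02 b03 b11 b12 b21 s0 s1 s2 : P} {I : Ideal P}

/-- The elements of `(I : p)` are the combinations of `f₁, p f₂, p² f₃, p³`. -/
theorem exists_combination_of_mul_mem (hρ : Function.Surjective ρ)
    (hker : ∀ x, ρ x = 0 → p ∣ x)
    (m1 : p * f1 ∈ I) (m2 : p ^ 2 * f2 ∈ I)
    (d1 : ∀ g, p * g ∈ I → ρ f1 ∣ ρ g) (d2 : ∀ g, p ^ 2 * g ∈ I → ρ f2 ∣ ρ g)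
    (d3 : ∀ g, p ^ 3 * g ∈ I → ρ f3 ∣ ρ g) {g : P} (hg : p * g ∈ I) :
    ∃ v0 v1 v2 v3, v0 * f1 + v1 * (p * f2) + v2 * (p ^ 2 * f3) + v3 * p ^ 3 = g := by
  obtain ⟨v0, g1, rfl⟩ := exists_eq_mul_add_of_map_dvd hρ hker (d1 g hg)
  have h1 : p ^ 2 * g1 ∈ I := by
    have := I.sub_mem hg (I.mul_mem_left v0 m1)
    convert this using 1; ring
  obtain ⟨v1, g2, rfl⟩ := exists_eq_mul_add_of_map_dvd hρ hker (d2 g1 h1)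
  have h2 : p ^ 3 * g2 ∈ I := by
    have := I.sub_mem h1 (I.mul_mem_left v1 m2)
    convert this using 1; ring
  obtain ⟨v2, g3, rfl⟩ := exists_eq_mul_add_of_map_dvd hρ hker (d3 g2 h2)
  exact ⟨v0, v1, v2, g3, by ring⟩

theorem combination_mem_iff [IsDomain A] (hρ : Function.Surjective ρ) (hker : ∀ x, ρ x = 0 → p ∣ x)
    (hp : ρ p = 0) (hp4 : p ^ 4 = 0)
    (h0 : f0 = s0 * f1 + p * b01 * f2 + p ^ 2 * b02 * f3 + p ^ 3 * b03)
    (h1 : f1 = s1 * f2 + p * b11 * f3 + p ^ 2 * b12) (h2 : f2 = s2 * f3 + p * b21)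
    (m0 : f0 ∈ I) (m1 : p * f1 ∈ I) (m2 : p ^ 2 * f2 ∈ I) (m3 : p ^ 3 * f3 ∈ I)
    (d0 : ∀ g, g ∈ I → ρ f0 ∣ ρ g)
    (d1 : ∀ g, p * g ∈ I → ρ f1 ∣ ρ g) (d2 : ∀ g, p ^ 2 * g ∈ I → ρ f2 ∣ ρ g)
    (d3 : ∀ g, p ^ 3 * g ∈ I → ρ f3 ∣ ρ g) (hf1 : ρ f1 ≠ 0) (hf2 : ρ f2 ≠ 0) (hf3 : ρ f3 ≠ 0)
    (v0 v1 v2 v3 : P) :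
    v0 * f1 + v1 * (p * f2) + v2 * (p ^ 2 * f3) + v3 * p ^ 3 ∈ I ↔
      ∃ w0 w1 w2 w3 u0 u1 u2 u3, v0 = s0 * w0 + p * u0 ∧ v1 = b01 * w0 + s1 * w1 + p * u1 ∧
        v2 = b02 * w0 + b11 * w1 + s2 * w2 + p * u2 ∧
        v3 = b03 * w0 + b12 * w1 + b21 * w2 + f3 * w3 + p * u3 := by
  have r0 : ρ f0 = ρ s0 * ρ f1 := by simp [h0, hp]
  have r1 : ρ f1 = ρ s1 * ρ f2 := by simp [h1, hp]
  have r2 : ρ f2 = ρ s2 * ρ f3 := by simp [h2, hp]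
  constructor
  · intro h
    obtain ⟨w0, u0, e0⟩ := exists_eq_mul_add_of_map_mul_dvd hρ hker (y := v0) hf1 r0 (by
      have := d0 _ h
      simpa [hp] using this)
    have k1 : p * ((v1 - b01 * w0) * f2 + p * ((v2 - b02 * w0) * f3) + p ^ 2 * (v3 - b03 * w0))
        ∈ I := by
      have := I.sub_mem h (I.add_mem (I.mul_mem_left w0 m0) (I.mul_mem_left u0 m1))
      convert this using 1
      rw [h0, e0]; ring
    obtain ⟨w1, u1, e1⟩ := exists_eq_mul_add_of_map_mul_dvd hρ hker (y := v1 - b01 * w0) hf2 r1 (by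
      have := d1 _ k1
      simpa [hp] using this)
    have k2 : p ^ 2 * ((v2 - b02 * w0 - b11 * w1) * f3 + p * (v3 - b03 * w0 - b12 * w1)) ∈ I := by
      have := I.sub_mem k1 (I.add_mem (I.mul_mem_left w1 m1) (I.mul_mem_left u1 m2))
      convert this using 1
      rw [h1, e1]; ring
    obtain ⟨w2, u2, e2⟩ := exists_eq_mul_add_of_map_mul_dvd hρ hker
      (y := v2 - b02 * w0 - b11 * w1) hf3 r2 (by
      have := d2 _ k2
      simpa [hp] using this)
    have k3 : p ^ 3 * (v3 - b03 * w0 - b12 * w1 - b21 * w2) ∈ I := by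
      have := I.sub_mem k2 (I.add_mem (I.mul_mem_left w2 m2) (I.mul_mem_left u2 m3))
      convert this using 1
      rw [h2, e2]; ring
    obtain ⟨w3, u3, e3⟩ := exists_eq_mul_add_of_map_dvd hρ hker (d3 _ k3)
    exact ⟨w0, w1, w2, w3, u0, u1, u2, u3, e0, by linear_combination e1, by linear_combination e2,
      by linear_combination e3⟩
  · rintro ⟨w0, w1, w2, w3, u0, u1, u2, u3, rfl, rfl, rfl, rfl⟩
    have := I.add_mem
      (I.add_mem (I.add_mem (I.mul_mem_left w0 m0) (I.mul_mem_left (w1 + u0) m1))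
        (I.mul_mem_left (w2 + u1) m2)) (I.mul_mem_left (w3 + u2) m3)
    convert this using 1
    rw [h0]
    linear_combination (-w1 * p) * h1 - (w2 * p ^ 2) * h2 + u3 * hp4

/-- Local Frobenius criterion for an ideal with a triangular canonical sequence. -/
theorem frobenius_local_iff_kernelDependent {κ : Type*} [Field κ] {σ : A →+* κ}
    [IsDomain A] [IsNoetherianRing P] (hρ : Function.Surjective ρ)
    (hker : ∀ x, ρ x = 0 → p ∣ x) (hp : ρ p = 0) (hp4 : p ^ 4 = 0) (hσ : Function.Surjective σ)
    (hr : ρ r ≠ 0) (hσr : ∀ a, σ a = 0 ↔ ρ r ∣ a) {e g0 g1 g2 g3 : ℕ} (he : e ≠ 0)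
    (hf0 : ρ f0 = ρ r ^ e)
    (h0 : f0 = r ^ g0 * f1 + p * b01 * f2 + p ^ 2 * b02 * f3 + p ^ 3 * b03)
    (h1 : f1 = r ^ g1 * f2 + p * b11 * f3 + p ^ 2 * b12) (h2 : f2 = r ^ g2 * f3 + p * b21)
    (h3 : f3 = r ^ g3)
    (m0 : f0 ∈ I) (m1 : p * f1 ∈ I) (m2 : p ^ 2 * f2 ∈ I) (m3 : p ^ 3 * f3 ∈ I)
    (d0 : ∀ g, g ∈ I → ρ f0 ∣ ρ g)
    (d1 : ∀ g, p * g ∈ I → ρ f1 ∣ ρ g) (d2 : ∀ g, p ^ 2 * g ∈ I → ρ f2 ∣ ρ g)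
    (d3 : ∀ g, p ^ 3 * g ∈ I → ρ f3 ∣ ρ g) :
    IsFrobeniusRing (P ⧸ I) ∧ IsLocalRing (P ⧸ I) ↔
      KernelDependent !![(0 : κ) ^ g0, 0, 0, 0; σ (ρ b01), 0 ^ g1, 0, 0;
        σ (ρ b02), σ (ρ b11), 0 ^ g2, 0; σ (ρ b03), σ (ρ b12), σ (ρ b21), 0 ^ g3] := by
  have hσr0 : σ (ρ r) = 0 := (hσr _).2 dvd_rfl
  have hf3 : ρ f3 ≠ 0 := by simp [h3, hr]
  have hf2 : ρ f2 ≠ 0 := by simp [h2, hp, hr, hf3]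
  have hf1 : ρ f1 ≠ 0 := by simp [h1, hp, hr, hf2]
  rw [frobenius_local_quotient_iff (φ := σ.comp ρ) (hσ.comp hρ)]
  · let M : Matrix (Fin 4) (Fin 4) A := !![ρ r ^ g0, 0, 0, 0; ρ b01, ρ r ^ g1, 0, 0;
        ρ b02, ρ b11, ρ r ^ g2, 0; ρ b03, ρ b12, ρ b21, ρ r ^ g3]
    have hM : M.det ≠ 0 := by
      simp [M, Matrix.det_fin_four_lowerTriangular, hr]
    have hMv (w : Fin 4 → A) : M.mulVec w = ![ρ r ^ g0 * w 0, ρ b01 * w 0 + ρ r ^ g1 * w 1,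
        ρ b02 * w 0 + ρ b11 * w 1 + ρ r ^ g2 * w 2,
        ρ b03 * w 0 + ρ b12 * w 1 + ρ b21 * w 2 + ρ r ^ g3 * w 3] :=
      Matrix.mulVec_fin_four_lowerTriangular ..
    rw [socle_dependent_iff_kernelDependent hρ hσ hr hp hσr hM
      (Fintype.linearCombination P ![f1, p * f2, p ^ 2 * f3, p ^ 3])]
    · have hMσ : M.map σ = !![(0 : κ) ^ g0, 0, 0, 0; σ (ρ b01), 0 ^ g1, 0, 0;
          σ (ρ b02), σ (ρ b11), 0 ^ g2, 0; σ (ρ b03), σ (ρ b12), σ (ρ b21), 0 ^ g3] := by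
        ext i j
        fin_cases i <;> fin_cases j <;> simp [M, hσr0]
      rw [hMσ]
    · intro v
      have := combination_mem_iff hρ hker hp hp4 h0 h1 h2 m0 m1 m2 m3 d0 d1 d2 d3 hf1 hf2 hf3
        (v 0) (v 1) (v 2) (v 3)
      simp only [Fintype.linearCombination_apply, Fin.sum_univ_four, smul_eq_mul]
      refine Iff.trans this ⟨?_, ?_⟩
      · rintro ⟨w0, w1, w2, w3, u0, u1, u2, u3, e0, e1, e2, e3⟩
        refine ⟨![ρ w0, ρ w1, ρ w2, ρ w3], ?_⟩
        ext i
        fin_cases i <;> simp [hMv, e0, e1, e2, e3, hp, h3]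
      · rintro ⟨w, hw⟩
        obtain ⟨w, rfl⟩ := hρ.comp_left w
        have hd (i : Fin 4) (y : P) (hy : ρ y = M.mulVec (ρ ∘ w) i) : ∃ u, v i = y + p * u := by
          obtain ⟨u, hu⟩ := hker (v i - y) (by
            rw [map_sub, hy, ← hw]
            simp)
          exact ⟨u, by linear_combination hu⟩
        obtain ⟨u0, e0⟩ := hd 0 (r ^ g0 * w 0) (by
          simp [hMv])
        obtain ⟨u1, e1⟩ := hd 1 (b01 * w 0 + r ^ g1 * w 1) (by
          simp [hMv])
        obtain ⟨u2, e2⟩ := hd 2 (b02 * w 0 + b11 * w 1 + r ^ g2 * w 2) (by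
          simp [hMv])
        obtain ⟨u3, e3⟩ := hd 3 (b03 * w 0 + b12 * w 1 + b21 * w 2 + f3 * w 3) (by
          simp [hMv, h3])
        exact ⟨_, _, _, _, u0, u1, u2, u3, e0, e1, e2, e3⟩
    · intro g hg
      obtain ⟨v0, v1, v2, v3, h⟩ :=
        exists_combination_of_mul_mem hρ hker m1 m2 d1 d2 d3 hg
      exact ⟨![v0, v1, v2, v3], by
        simpa [Fintype.linearCombination_apply, Fin.sum_univ_four] using h⟩
  · intro x hx
    refine (hσr _).2 (dvd_trans ?_ (d0 x hx))
    rw [hf0]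
    exact dvd_pow_self _ he
  · intro x hx
    obtain ⟨y, z, h⟩ := exists_eq_mul_add_of_map_dvd hρ hker (f := f0) (y := x ^ e) (by
      rw [hf0, map_pow]
      exact pow_dvd_pow_of_dvd ((hσr _).1 hx) e)
    refine ⟨e * 4, ?_⟩
    rw [pow_mul, ← Ideal.Quotient.eq_zero_iff_mem, map_pow, h, map_add, map_mul,
      Ideal.Quotient.eq_zero_iff_mem.2 m0, zero_mul, zero_add, ← map_pow, mul_pow, hp4, zero_mul,
      map_zero]

end Triangular

section LinearAlgebra

theorem eq_zero_iff_of_fin_four {A : Type*} [Zero A] {w : Fin 4 → A} :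
    w = 0 ↔ w 0 = 0 ∧ w 1 = 0 ∧ w 2 = 0 ∧ w 3 = 0 := by
  simp [funext_iff, Fin.forall_fin_succ]

theorem Matrix.mulVec_fin_four_lowerTriangular_eq_zero_iff {A : Type*} [CommRing A]
    {d0 d1 d2 d3 a01 a02 a03 a11 a12 a21 : A} {w : Fin 4 → A} :
    !![d0, 0, 0, 0; a01, d1, 0, 0; a02, a11, d2, 0; a03, a12, a21, d3].mulVec w = 0 ↔
      d0 * w 0 = 0 ∧ a01 * w 0 + d1 * w 1 = 0 ∧ a02 * w 0 + a11 * w 1 + d2 * w 2 = 0 ∧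
        a03 * w 0 + a12 * w 1 + a21 * w 2 + d3 * w 3 = 0 := by
  rw [Matrix.mulVec_fin_four_lowerTriangular, eq_zero_iff_of_fin_four]
  rfl

variable {κ : Type*} [Field κ] (d0 d1 d2 b01 b02 b03 b11 b12 b21 : κ)

theorem kernelDependent_lowerTriangular_last_zero :
    KernelDependent !![d0, 0, 0, 0; b01, d1, 0, 0; b02, b11, d2, 0; b03, b12, b21, 0] ↔
      ∀ x y z, d0 * x = 0 → b01 * x + d1 * y = 0 → b02 * x + b11 * y + d2 * z = 0 →
        b03 * x + b12 * y + b21 * z = 0 → x = 0 ∧ y = 0 ∧ z = 0 := by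
  rw [kernelDependent_iff_of_apply_ne_zero (i := 3) (u := ![0, 0, 0, 1])
    (by rw [Matrix.mulVec_fin_four_lowerTriangular_eq_zero_iff]; simp) (by simp)]
  simp only [Matrix.mulVec_fin_four_lowerTriangular_eq_zero_iff]
  simp only [eq_zero_iff_of_fin_four]
  refine ⟨fun H x y z h0 h1 h2 h3 => ?_, fun H w h hw => ?_⟩
  · simpa using H ![x, y, z, 0] (by simp [h0, h1, h2, h3]) (by simp)
  · have := H (w 0) (w 1) (w 2)
    grind

theorem kernelDependent_lowerTriangular_last_one :
    KernelDependent !![d0, 0, 0, 0; b01, d1, 0, 0; b02, b11, 0, 0; b03, b12, b21, 1] ↔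
      ∀ x y, d0 * x = 0 → b01 * x + d1 * y = 0 → b02 * x + b11 * y = 0 → x = 0 ∧ y = 0 := by
  rw [kernelDependent_iff_of_apply_ne_zero (i := 2) (u := ![0, 0, 1, -b21])
    (by rw [Matrix.mulVec_fin_four_lowerTriangular_eq_zero_iff]; simp) (by simp)]
  simp only [Matrix.mulVec_fin_four_lowerTriangular_eq_zero_iff]
  simp only [eq_zero_iff_of_fin_four]
  refine ⟨fun H x y h0 h1 h2 => ?_, fun H w h hw => ?_⟩
  · have := H ![x, y, 0, -(b03 * x + b12 * y)] (by simp [h0, h1, h2]) (by simp)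
    simp_all
  · have := H (w 0) (w 1)
    grind

theorem kernelDependent_lowerTriangular_last_one_one :
    KernelDependent !![d0, 0, 0, 0; b01, 0, 0, 0; b02, b11, 1, 0; b03, b12, b21, 1] ↔
      ∀ x, d0 * x = 0 → b01 * x = 0 → x = 0 := by
  have hu : !![d0, 0, 0, 0; b01, 0, 0, 0; b02, b11, 1, 0; b03, b12, b21, 1].mulVec
      ![0, 1, -b11, -(b12 - b21 * b11)] = 0 := by
    rw [Matrix.mulVec_fin_four_lowerTriangular_eq_zero_iff]
    simp
    ring
  rw [kernelDependent_iff_of_apply_ne_zero (i := 1) hu (by simp)]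
  simp only [Matrix.mulVec_fin_four_lowerTriangular_eq_zero_iff]
  simp only [eq_zero_iff_of_fin_four]
  refine ⟨fun H x h0 h1 => ?_, fun H w h hw => ?_⟩
  · exact (H ![x, 0, -(b02 * x), -(b03 * x - b21 * (b02 * x))]
      (by simp [h0, h1]; ring) (by simp)).1
  · have := H (w 0)
    grind

theorem kernelDependent_lowerTriangular_zero_one_one_one :
    KernelDependent !![0, 0, 0, 0; b01, 1, 0, 0; b02, b11, 1, 0; b03, b12, b21, 1] := by
  have hu : !![0, 0, 0, 0; b01, 1, 0, 0; b02, b11, 1, 0; b03, b12, b21, 1].mulVec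
      ![1, -b01, -(b02 - b11 * b01), -(b03 - b12 * b01 - b21 * (b02 - b11 * b01))] = 0 := by
    rw [Matrix.mulVec_fin_four_lowerTriangular_eq_zero_iff]
    simp
    constructor <;> ring
  rw [kernelDependent_iff_of_apply_ne_zero (i := 0) hu (by simp)]
  simp only [Matrix.mulVec_fin_four_lowerTriangular_eq_zero_iff]
  simp only [eq_zero_iff_of_fin_four]
  grind

variable {d0 d1 d2 b01 b02 b03 b11 b12 b21}

theorem kernelDependent_one_one_zero_zero :
    KernelDependent !![1, 0, 0, 0; b01, 1, 0, 0; b02, b11, 0, 0; b03, b12, b21, 0] ↔ b21 ≠ 0 := by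
  rw [kernelDependent_lowerTriangular_last_zero]
  exact ⟨fun H => by have := H 0 0 1; simp_all, by grind⟩

theorem kernelDependent_one_zero_one_zero :
    KernelDependent !![1, 0, 0, 0; b01, 0, 0, 0; b02, b11, 1, 0; b03, b12, b21, 0] ↔
      b12 - b11 * b21 ≠ 0 := by
  rw [kernelDependent_lowerTriangular_last_zero]
  exact ⟨fun H => by have := H 0 1 (-b11); grind, by grind⟩

theorem kernelDependent_one_zero_zero_one :
    KernelDependent !![1, 0, 0, 0; b01, 0, 0, 0; b02, b11, 0, 0; b03, b12, b21, 1] ↔ b11 ≠ 0 := by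
  rw [kernelDependent_lowerTriangular_last_one]
  exact ⟨fun H => by have := H 0 1; simp_all, by grind⟩

theorem kernelDependent_one_zero_zero_zero :
    KernelDependent !![1, 0, 0, 0; b01, 0, 0, 0; b02, b11, 0, 0; b03, b12, b21, 0] ↔
      b21 ≠ 0 ∧ b11 ≠ 0 := by
  rw [kernelDependent_lowerTriangular_last_zero]
  exact ⟨fun H => by have := H 0 0 1; have := H 0 b21 (-b12); grind, by grind⟩

theorem kernelDependent_zero_one_one_zero :
    KernelDependent !![0, 0, 0, 0; b01, 1, 0, 0; b02, b11, 1, 0; b03, b12, b21, 0] ↔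
      b21 * (b02 - b01 * b11) - (b03 - b01 * b12) ≠ 0 := by
  rw [kernelDependent_lowerTriangular_last_zero]
  exact ⟨fun H => by have := H 1 (-b01) (-(b02 - b01 * b11)); grind, by grind⟩

theorem kernelDependent_zero_one_zero_one :
    KernelDependent !![0, 0, 0, 0; b01, 1, 0, 0; b02, b11, 0, 0; b03, b12, b21, 1] ↔
      b02 - b01 * b11 ≠ 0 := by
  rw [kernelDependent_lowerTriangular_last_one]
  exact ⟨fun H => by have := H 1 (-b01); grind, by grind⟩

theorem kernelDependent_zero_zero_one_one :
    KernelDependent !![0, 0, 0, 0; b01, 0, 0, 0; b02, b11, 1, 0; b03, b12, b21, 1] ↔ b01 ≠ 0 := by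
  rw [kernelDependent_lowerTriangular_last_one_one]
  exact ⟨fun H => by have := H 1; grind, by grind⟩

theorem kernelDependent_zero_one_zero_zero :
    KernelDependent !![0, 0, 0, 0; b01, 1, 0, 0; b02, b11, 0, 0; b03, b12, b21, 0] ↔
      b21 ≠ 0 ∧ b02 - b01 * b11 ≠ 0 := by
  rw [kernelDependent_lowerTriangular_last_zero]
  exact ⟨fun H => by
    have := H 0 0 1
    have := H b21 (-(b01 * b21)) (-(b03 - b01 * b12))
    grind, by grind⟩

theorem kernelDependent_zero_zero_one_zero :
    KernelDependent !![0, 0, 0, 0; b01, 0, 0, 0; b02, b11, 1, 0; b03, b12, b21, 0] ↔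
      b12 - b11 * b21 ≠ 0 ∧ b01 ≠ 0 := by
  rw [kernelDependent_lowerTriangular_last_zero]
  exact ⟨fun H => by
    have := H 0 1 (-b11)
    have := H (b12 - b11 * b21) (-(b03 - b02 * b21))
      (-(b02 * (b12 - b11 * b21) - b11 * (b03 - b02 * b21)))
    grind, by grind⟩

theorem kernelDependent_zero_zero_zero_one :
    KernelDependent !![0, 0, 0, 0; b01, 0, 0, 0; b02, b11, 0, 0; b03, b12, b21, 1] ↔
      b11 ≠ 0 ∧ b01 ≠ 0 := by
  rw [kernelDependent_lowerTriangular_last_one]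
  exact ⟨fun H => by have := H 0 1; have := H b11 (-b02); grind, by grind⟩

theorem kernelDependent_zero_zero_zero_zero :
    KernelDependent !![0, 0, 0, 0; b01, 0, 0, 0; b02, b11, 0, 0; b03, b12, b21, 0] ↔
      b21 ≠ 0 ∧ b11 ≠ 0 ∧ b01 ≠ 0 := by
  rw [kernelDependent_lowerTriangular_last_zero]
  exact ⟨fun H => by
    have := H 0 0 1
    have := H 0 b21 (-b12)
    have := H (b11 * b21) (-(b02 * b21)) (-(b11 * b03 - b02 * b12))
    grind, by grind⟩

end LinearAlgebra

section ChainRing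

variable {R : Type*} [CommRing R] {π : R}

theorem isNoetherianRing_of_maximalIdeal_eq_span [IsLocalRing R]
    (hmax : IsLocalRing.maximalIdeal R = Ideal.span {π}) {n : ℕ} (hnil : π ^ n = 0) :
    IsNoetherianRing R := by
  refine IsNoetherianRing.of_prime fun J hJ => ⟨{π}, ?_⟩
  refine le_antisymm ?_ ((IsLocalRing.le_maximalIdeal hJ.ne_top).trans_eq (by simpa using hmax))
  simpa using hJ.mem_of_pow_mem n (hnil ▸ J.zero_mem)

theorem redMod_surjective : Function.Surjective (redMod π) :=
  Polynomial.map_surjective _ Ideal.Quotient.mk_surjective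

theorem redMod_C_self : redMod π (C π) = 0 := by
  simp [redMod]

theorem C_dvd_of_redMod_eq_zero {x : R[X]} (hx : redMod π x = 0) : C π ∣ x := by
  rw [C_dvd_iff_dvd_coeff]
  intro i
  have := congrArg (fun q => q.coeff i) hx
  simpa [redMod, Ideal.Quotient.eq_zero_iff_mem, Ideal.mem_span_singleton] using this

/-- The reduction of the `i`-th member of a canonical sequence generates the `i`-th torsion
ideal. -/
theorem IsCanonicalSequence.redMod_dvd (hmax : (Ideal.span {π}).IsMaximal) {n : ℕ}
    {I : Ideal R[X]} {f : ℕ → R[X]} (hcan : IsCanonicalSequence π n I f) {i : ℕ} (hi : i < n)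
    {g : R[X]} (hg : C π ^ i * g ∈ I) : redMod π (f i) ∣ redMod π g := by
  let _ := Ideal.Quotient.field (Ideal.span {π})
  obtain ⟨hf, hdeg⟩ := hcan i hi
  rcases hdeg g hg with h | ⟨hne, -⟩
  · simp [h]
  obtain ⟨q, hq⟩ := redMod_surjective (redMod π g / redMod π (f i))
  have hrem : redMod π (g - f i * q) = redMod π g % redMod π (f i) := by
    rw [map_sub, map_mul, hq, sub_eq_iff_eq_add, EuclideanDomain.mod_add_div]
  have hmem : C π ^ i * (g - f i * q) ∈ I := by
    have := I.sub_mem hg (I.mul_mem_left q hf)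
    convert this using 1
    ring
  rcases hdeg _ hmem with h | ⟨-, h⟩
  · exact (EuclideanDomain.mod_eq_zero).1 (hrem ▸ h)
  · rw [hrem] at h
    exact absurd h (not_le.2 (Polynomial.degree_mod_lt _ hne))

end ChainRing

universe u

/-- For an ideal with a canonical sequence in standard form, the Frobenius-local property of the
quotient is decided by the kernel of a triangular matrix over the residue field `κ` of `r̄`. -/
theorem exists_frobenius_local_iff_kernelDependent {R : Type u} [CommRing R] [IsLocalRing R] {π : R}
    (hmax : IsLocalRing.maximalIdeal R = Ideal.span {π}) (hnil : π ^ 4 = 0)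
    {r b21 b11 b12 b01 b02 b03 : R[X]} (hr : Irreducible (redMod π r))
    {e0 e1 e2 e3 : ℕ} (h32 : e3 ≤ e2) (h21 : e2 ≤ e1) (h10 : e1 ≤ e0) (he0 : 0 < e0)
    {I : Ideal R[X]}
    (hcan : IsCanonicalSequence π 4 I (fun j =>
      if j = 0 then
        r ^ e0 + C π * (b21 * r ^ (e0 - e2) + b11 * r ^ (e0 - e1 + e3) + b01 * r ^ e2) +
          C π ^ 2 * (b12 * r ^ (e0 - e1) + b01 * b21 + b02 * r ^ e3) + C π ^ 3 * b03
      else if j = 1 then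
        r ^ e1 + C π * (b21 * r ^ (e1 - e2) + b11 * r ^ e3) + C π ^ 2 * b12
      else if j = 2 then r ^ e2 + C π * b21
      else r ^ e3)) :
    ∃ (κ : Type u) (_ : Field κ) (σ : (R ⧸ Ideal.span {π})[X] →+* κ),
      (∀ a, σ a = 0 ↔ redMod π r ∣ a) ∧
      (IsFrobeniusRing (R[X] ⧸ I) ∧ IsLocalRing (R[X] ⧸ I) ↔
        KernelDependent !![(0 : κ) ^ (e0 - e1), 0, 0, 0;
          σ (redMod π b01), 0 ^ (e1 - e2), 0, 0;
          σ (redMod π b02), σ (redMod π b11), 0 ^ (e2 - e3), 0;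
          σ (redMod π b03), σ (redMod π b12), σ (redMod π b21), 0 ^ e3]) := by
  have hM : (Ideal.span {π}).IsMaximal := hmax ▸ inferInstance
  let _ := Ideal.Quotient.field (Ideal.span {π})
  have := isNoetherianRing_of_maximalIdeal_eq_span hmax hnil
  have : (Ideal.span {redMod π r}).IsMaximal := PrincipalIdealRing.isMaximal_of_irreducible hr
  let _ := Ideal.Quotient.field (Ideal.span {redMod π r})
  have hσr (a) : Ideal.Quotient.mk (Ideal.span {redMod π r}) a = 0 ↔ redMod π r ∣ a := by
    rw [Ideal.Quotient.eq_zero_iff_mem, Ideal.mem_span_singleton]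
  refine ⟨_, inferInstance, Ideal.Quotient.mk (Ideal.span {redMod π r}), hσr, ?_⟩
  obtain ⟨m0, -⟩ := hcan 0 (by norm_num)
  obtain ⟨m1, -⟩ := hcan 1 (by norm_num)
  obtain ⟨m2, -⟩ := hcan 2 (by norm_num)
  obtain ⟨m3, -⟩ := hcan 3 (by norm_num)
  have d0 (g) := hcan.redMod_dvd hM (i := 0) (by norm_num) (g := g)
  have d1 (g) := hcan.redMod_dvd hM (i := 1) (by norm_num) (g := g)
  have d2 (g) := hcan.redMod_dvd hM (i := 2) (by norm_num) (g := g)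
  have d3 (g) := hcan.redMod_dvd hM (i := 3) (by norm_num) (g := g)
  simp only [pow_zero, one_mul, pow_one, if_true, one_ne_zero, if_false, OfNat.ofNat_ne_zero,
    OfNat.ofNat_ne_one, Nat.reduceEqDiff] at m0 m1 m2 m3 d0 d1 d2 d3
  refine frobenius_local_iff_kernelDependent redMod_surjective
    (fun _ => C_dvd_of_redMod_eq_zero) redMod_C_self (by rw [← C_pow, hnil, C_0])
    Ideal.Quotient.mk_surjective hr.ne_zero hσr he0.ne' ?_ ?_ ?_ ?_ rfl m0 m1 m2 m3 d0 d1 d2 d3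
  · simp [redMod_C_self]
  · rw [show e0 - e2 = e0 - e1 + (e1 - e2) by omega]
    linear_combination -pow_sub_mul_pow r h10
  · linear_combination -pow_sub_mul_pow r h21
  · linear_combination -pow_sub_mul_pow r h32

/-- Theorem 7.5 (nilpotency 4): Frobenius-local criteria for an ideal `I` with canonical
sequence `f₃ = r^{e₃}`, `f₂ = r^{e₂} + π b₂₁`,
`f₁ = r^{e₁} + π (b₂₁ r^{e₁-e₂} + b₁₁ r^{e₃}) + π² b₁₂`,
`f₀ = r^{e₀} + π (b₂₁ r^{e₀-e₂} + b₁₁ r^{e₀-e₁+e₃} + b₀₁ r^{e₂})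
      + π² (b₁₂ r^{e₀-e₁} + b₀₁ b₂₁ + b₀₂ r^{e₃}) + π³ b₀₃`, `r̄` irreducible. -/
theorem chain_nilpotency_four_frobenius_local {R : Type*} [CommRing R] [IsLocalRing R]
    (π : R) (hmax : IsLocalRing.maximalIdeal R = Ideal.span {π})
    (hnil : π ^ 4 = 0) (hπ : π ^ 3 ≠ 0)
    (r b21 b11 b12 b01 b02 b03 : R[X]) (hr : Irreducible (redMod π r))
    (e0 e1 e2 e3 : ℕ) (h32 : e3 ≤ e2) (h21 : e2 ≤ e1) (h10 : e1 ≤ e0) (he0 : 0 < e0)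
    (I : Ideal R[X])
    (hcan : IsCanonicalSequence π 4 I (fun j =>
      if j = 0 then
        r ^ e0 + C π * (b21 * r ^ (e0 - e2) + b11 * r ^ (e0 - e1 + e3) + b01 * r ^ e2) +
          C π ^ 2 * (b12 * r ^ (e0 - e1) + b01 * b21 + b02 * r ^ e3) + C π ^ 3 * b03
      else if j = 1 then
        r ^ e1 + C π * (b21 * r ^ (e1 - e2) + b11 * r ^ e3) + C π ^ 2 * b12
      else if j = 2 then r ^ e2 + C π * b21
      else r ^ e3)) :
    (({e0, e1, e2, e3, 0} : Finset ℕ).card = 2 →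
      (IsFrobeniusRing (R[X] ⧸ I) ∧ IsLocalRing (R[X] ⧸ I))) ∧
    (e0 = e1 → e1 = e2 → e3 < e2 → 0 < e3 →
      ((IsFrobeniusRing (R[X] ⧸ I) ∧ IsLocalRing (R[X] ⧸ I)) ↔
        ¬ redMod π r ∣ redMod π b21)) ∧
    (e0 = e1 → e2 < e1 → e2 = e3 → 0 < e3 →
      ((IsFrobeniusRing (R[X] ⧸ I) ∧ IsLocalRing (R[X] ⧸ I)) ↔
        ¬ redMod π r ∣ (redMod π b12 - redMod π b11 * redMod π b21))) ∧
    (e0 = e1 → e2 < e1 → e3 < e2 → e3 = 0 →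
      ((IsFrobeniusRing (R[X] ⧸ I) ∧ IsLocalRing (R[X] ⧸ I)) ↔
        ¬ redMod π r ∣ redMod π b11)) ∧
    (e0 = e1 → e2 < e1 → e3 < e2 → 0 < e3 →
      ((IsFrobeniusRing (R[X] ⧸ I) ∧ IsLocalRing (R[X] ⧸ I)) ↔
        (¬ redMod π r ∣ redMod π b21 ∧ ¬ redMod π r ∣ redMod π b11))) ∧
    (e1 < e0 → e1 = e2 → e2 = e3 → 0 < e3 →
      ((IsFrobeniusRing (R[X] ⧸ I) ∧ IsLocalRing (R[X] ⧸ I)) ↔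
        ¬ redMod π r ∣ (redMod π b21 * (redMod π b02 - redMod π b01 * redMod π b11) -
          (redMod π b03 - redMod π b01 * redMod π b12)))) ∧
    (e1 < e0 → e1 = e2 → e3 < e2 → e3 = 0 →
      ((IsFrobeniusRing (R[X] ⧸ I) ∧ IsLocalRing (R[X] ⧸ I)) ↔
        ¬ redMod π r ∣ (redMod π b02 - redMod π b01 * redMod π b11))) ∧
    (e1 < e0 → e2 < e1 → e2 = 0 → e3 = 0 →
      ((IsFrobeniusRing (R[X] ⧸ I) ∧ IsLocalRing (R[X] ⧸ I)) ↔
        ¬ redMod π r ∣ redMod π b01)) ∧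
    (e1 < e0 → e1 = e2 → e3 < e2 → 0 < e3 →
      ((IsFrobeniusRing (R[X] ⧸ I) ∧ IsLocalRing (R[X] ⧸ I)) ↔
        (¬ redMod π r ∣ redMod π b21 ∧
          ¬ redMod π r ∣ (redMod π b02 - redMod π b01 * redMod π b11)))) ∧
    (e1 < e0 → e2 < e1 → e2 = e3 → 0 < e3 →
      ((IsFrobeniusRing (R[X] ⧸ I) ∧ IsLocalRing (R[X] ⧸ I)) ↔
        (¬ redMod π r ∣ (redMod π b12 - redMod π b11 * redMod π b21) ∧
          ¬ redMod π r ∣ redMod π b01))) ∧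
    (e1 < e0 → e2 < e1 → e3 < e2 → e3 = 0 →
      ((IsFrobeniusRing (R[X] ⧸ I) ∧ IsLocalRing (R[X] ⧸ I)) ↔
        (¬ redMod π r ∣ redMod π b11 ∧ ¬ redMod π r ∣ redMod π b01))) ∧
    (e1 < e0 → e2 < e1 → e3 < e2 → 0 < e3 →
      ((IsFrobeniusRing (R[X] ⧸ I) ∧ IsLocalRing (R[X] ⧸ I)) ↔
        (¬ redMod π r ∣ redMod π b21 ∧ ¬ redMod π r ∣ redMod π b11 ∧
          ¬ redMod π r ∣ redMod π b01))) := by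
  obtain ⟨κ, _, σ, hσr, H⟩ :=
    exists_frobenius_local_iff_kernelDependent hmax hnil hr h32 h21 h10 he0 hcan
  simp only [H, ← hσr, map_sub, map_mul, ← ne_eq]
  have one {g : ℕ} (hg : g = 0) : (0 : κ) ^ g = 1 := by rw [hg, pow_zero]
  have zero {g : ℕ} (hg : g ≠ 0) : (0 : κ) ^ g = 0 := zero_pow hg
  refine ⟨fun hcard => ?_, fun h0 h1 h2 h3 => ?_, fun h0 h1 h2 h3 => ?_, fun h0 h1 h2 h3 => ?_,
    fun h0 h1 h2 h3 => ?_, fun h0 h1 h2 h3 => ?_, fun h0 h1 h2 h3 => ?_, fun h0 h1 h2 h3 => ?_,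
    fun h0 h1 h2 h3 => ?_, fun h0 h1 h2 h3 => ?_, fun h0 h1 h2 h3 => ?_, fun h0 h1 h2 h3 => ?_⟩
  · have hset : ({e0, 0} : Finset ℕ) = {e0, e1, e2, e3, 0} :=
      Finset.eq_of_subset_of_card_le (by grind) (by rw [hcard, Finset.card_pair he0.ne'])
    have h1 : e1 ∈ ({e0, 0} : Finset ℕ) := by simp [hset]
    have h2 : e2 ∈ ({e0, 0} : Finset ℕ) := by simp [hset]
    have h3 : e3 ∈ ({e0, 0} : Finset ℕ) := by simp [hset]
    simp only [Finset.mem_insert, Finset.mem_singleton] at h1 h2 h3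
    obtain h | h | h | h : e1 < e0 ∨ e2 < e1 ∨ e3 < e2 ∨ 0 < e3 := by omega
    · rw [zero (show e0 - e1 ≠ 0 by omega),
        one (show e1 - e2 = 0 by omega),
        one (show e2 - e3 = 0 by omega),
        one (show e3 = 0 by omega)]
      exact kernelDependent_lowerTriangular_zero_one_one_one _ _ _ _ _ _
    · rw [one (show e0 - e1 = 0 by omega),
        zero (show e1 - e2 ≠ 0 by omega),
        one (show e2 - e3 = 0 by omega),
        one (show e3 = 0 by omega),
        kernelDependent_lowerTriangular_last_one_one]
      simp
    · rw [one (show e0 - e1 = 0 by omega),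
        one (show e1 - e2 = 0 by omega),
        zero (show e2 - e3 ≠ 0 by omega),
        one (show e3 = 0 by omega),
        kernelDependent_lowerTriangular_last_one]
      grind
    · rw [one (show e0 - e1 = 0 by omega),
        one (show e1 - e2 = 0 by omega),
        one (show e2 - e3 = 0 by omega),
        zero (show e3 ≠ 0 by omega),
        kernelDependent_lowerTriangular_last_zero]
      grind
  · rw [one (show e0 - e1 = 0 by omega),
      one (show e1 - e2 = 0 by omega),
      zero (show e2 - e3 ≠ 0 by omega),
      zero (show e3 ≠ 0 by omega),
      kernelDependent_one_one_zero_zero]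
  · rw [one (show e0 - e1 = 0 by omega),
      zero (show e1 - e2 ≠ 0 by omega),
      one (show e2 - e3 = 0 by omega),
      zero (show e3 ≠ 0 by omega),
      kernelDependent_one_zero_one_zero]
  · rw [one (show e0 - e1 = 0 by omega),
      zero (show e1 - e2 ≠ 0 by omega),
      zero (show e2 - e3 ≠ 0 by omega),
      one (show e3 = 0 by omega),
      kernelDependent_one_zero_zero_one]
  · rw [one (show e0 - e1 = 0 by omega),
      zero (show e1 - e2 ≠ 0 by omega),
      zero (show e2 - e3 ≠ 0 by omega),
      zero (show e3 ≠ 0 by omega),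
      kernelDependent_one_zero_zero_zero]
  · rw [zero (show e0 - e1 ≠ 0 by omega),
      one (show e1 - e2 = 0 by omega),
      one (show e2 - e3 = 0 by omega),
      zero (show e3 ≠ 0 by omega),
      kernelDependent_zero_one_one_zero]
  · rw [zero (show e0 - e1 ≠ 0 by omega),
      one (show e1 - e2 = 0 by omega),
      zero (show e2 - e3 ≠ 0 by omega),
      one (show e3 = 0 by omega),
      kernelDependent_zero_one_zero_one]
  · rw [zero (show e0 - e1 ≠ 0 by omega),
      zero (show e1 - e2 ≠ 0 by omega),
      one (show e2 - e3 = 0 by omega),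
      one (show e3 = 0 by omega),
      kernelDependent_zero_zero_one_one]
  · rw [zero (show e0 - e1 ≠ 0 by omega),
      one (show e1 - e2 = 0 by omega),
      zero (show e2 - e3 ≠ 0 by omega),
      zero (show e3 ≠ 0 by omega),
      kernelDependent_zero_one_zero_zero]
  · rw [zero (show e0 - e1 ≠ 0 by omega),
      zero (show e1 - e2 ≠ 0 by omega),
      one (show e2 - e3 = 0 by omega),
      zero (show e3 ≠ 0 by omega),
      kernelDependent_zero_zero_one_zero]
  · rw [zero (show e0 - e1 ≠ 0 by omega),
      zero (show e1 - e2 ≠ 0 by omega),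
      zero (show e2 - e3 ≠ 0 by omega),
      one (show e3 = 0 by omega),
      kernelDependent_zero_zero_zero_one]
  · rw [zero (show e0 - e1 ≠ 0 by omega),
      zero (show e1 - e2 ≠ 0 by omega),
      zero (show e2 - e3 ≠ 0 by omega),
      zero (show e3 ≠ 0 by omega),
      kernelDependent_zero_zero_zero_zero]
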